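/- Let i ≥ −1 and n ≥ 1, and suppose C ∈ C_i(n) has exactly t > 0 plus-full-sets. Then there exist a unique C̃ ∈ N_i(n−t) and a unique t-tuple (r_1, …, r_t) such that C = (φ_{i,n−1}^{r_1} ∘ φ_{i,n−2}^{r_2} ∘ ⋯ ∘ φ_{i,n−t}^{r_t})(C̃). -/

import Mathlib

/-!
Common definitions for formalizing "A recursion on maximal chains in the Tamari lattices"
(L. Nelson).

* Young diagrams are encoded by their row-length functions `lam : ℕ → ℕ` (rows indexed from 1,
  with `lam 0 = 0`).
* Dyck paths are lists of steps (north/east).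
* Tableaux are encoded by entry functions `f : ℕ × ℕ → ℕ` (1-indexed boxes; value `0` means
  "no box").  The label of box `(x, y)` is `f (x, y)`.
-/

noncomputable section

namespace TamariMaxChains

/-- A step of a lattice path: north or east. -/
inductive Step : Type
  | N : Step
  | E : Step
deriving DecidableEq

/-- Number of north steps of a path. -/
def nCount (p : List Step) : ℕ := p.count Step.N

/-- Number of east steps of a path. -/
def eCount (p : List Step) : ℕ := p.count Step.E

/-- `p` is a Dyck path: equally many norths and easts, and every prefix has at least as many
north steps as east steps (the path never goes below the diagonal `y = x`). -/
def IsDyck (p : List Step) : Prop :=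
  nCount p = eCount p ∧ ∀ q : List Step, q <+: p → eCount q ≤ nCount q

/-- `q` is a prime Dyck path: it meets the slope-one line joining its endpoints only at its
endpoints. -/
def IsPrimeDyck (q : List Step) : Prop :=
  q ≠ [] ∧ nCount q = eCount q ∧
    ∀ s : List Step, s <+: q → s ≠ [] → s ≠ q → eCount s < nCount s

/-- Covering relation of the Tamari lattice on Dyck paths:  `TamariCoverD P' P` means `P'`
covers `P`, i.e. `P'` is obtained from `P` by swapping an east step that is followed by a north
step with the prime Dyck subpath following it. -/
def TamariCoverD (P' P : List Step) : Prop :=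
  ∃ a q b : List Step, IsPrimeDyck q ∧
    P = a ++ Step.E :: (q ++ b) ∧ P' = a ++ (q ++ Step.E :: b)

/-- `lam` is the row-length function of a Young diagram: rows are indexed from `1`,
`lam x` is the number of boxes in row `x`, rows weakly decrease, finitely many boxes. -/
def IsDiagram (lam : ℕ → ℕ) : Prop :=
  lam 0 = 0 ∧ (∀ x, 1 ≤ x → lam (x + 1) ≤ lam x) ∧ ∃ N, ∀ x, N ≤ x → lam x = 0

/-- The height (number of north steps) of the prime path of row `d ≥ 1` of the Young diagram
with row lengths `lam`:  the least `t ≥ 1` such that either `t = d` (row `0` being regarded as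
an infinite row of boxes) or row `d - t` has length at least `lam d + t`. -/
def primeHeight (lam : ℕ → ℕ) (d : ℕ) : ℕ :=
  sInf {t | 1 ≤ t ∧ (t = d ∨ (t < d ∧ lam d + t ≤ lam (d - t)))}

/-- The last box of row `d` is a corner box (last box of its row and lowest box of
its column). -/
def IsCorner (lam : ℕ → ℕ) (d : ℕ) : Prop := 1 ≤ d ∧ 1 ≤ lam d ∧ lam (d + 1) < lam d

/-- The result of removing the `B`-strip of the last box `B` of row `d`: the last box of each of
the rows `d - h + 1, …, d` is removed, where `h` is the height of the prime path of row `d`. -/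
def removeStrip (lam : ℕ → ℕ) (d : ℕ) : ℕ → ℕ := fun x =>
  if d + 1 ≤ x + primeHeight lam d ∧ x ≤ d then lam x - 1 else lam x

/-- Covering relation of the Tamari lattice on Young diagrams:  `mu` covers `lam` iff `mu` is
obtained from `lam` by removing the `B`-strip of a corner box `B`. -/
def TamariCoverY (mu lam : ℕ → ℕ) : Prop := ∃ d, IsCorner lam d ∧ mu = removeStrip lam d

/-- The `B`-strip of the last box `B` of row `d`: the set of last boxes of rows
`d - h + 1, …, d`, where `h` is the height of the prime path of row `d`. -/
def stripSet (lam : ℕ → ℕ) (d : ℕ) : Set (ℕ × ℕ) :=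
  {b | b.2 = lam b.1 ∧ 1 ≤ b.2 ∧ d + 1 ≤ b.1 + primeHeight lam d ∧ b.1 ≤ d}

/-- The enclosure of the `B`-strip of the last box `B = (d, lam d)` of row `d`: all boxes
`(x, y)` with `d - h ≤ x ≤ d` and `lam d ≤ y ≤ lam d + h`, where row `0` is regarded as an
infinite row of boxes. -/
def enclosure (lam : ℕ → ℕ) (d : ℕ) : Set (ℕ × ℕ) :=
  {b | (b.1 = 0 ∨ b.2 ≤ lam b.1) ∧ 1 ≤ b.2 ∧
    d ≤ b.1 + primeHeight lam d ∧ b.1 ≤ d ∧ lam d ≤ b.2 ∧ b.2 ≤ lam d + primeHeight lam d}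

/-- The Dyck path of length `2 n` corresponding to the Young diagram `lam` contained in the
staircase `δ_{n-1}` (the Dyck path is the silhouette of the Young diagram). -/
def toDyck (n : ℕ) (lam : ℕ → ℕ) : List Step :=
  ((List.range n).flatMap fun k =>
    List.replicate (lam (n - k) - lam (n - k + 1)) Step.E ++ [Step.N]) ++
    List.replicate (n - lam 1) Step.E

/-- The prime path of row `d` of the Young diagram `lam`, as its list of steps (read from its
lower-left endpoint). -/
def primePathList (lam : ℕ → ℕ) (d : ℕ) : List Step :=
  Step.N :: ((((List.range (primeHeight lam d - 1)).flatMap fun j =>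
    List.replicate (lam (d - 1 - j) - lam (d - j)) Step.E ++ [Step.N])) ++
    List.replicate (lam d + primeHeight lam d - lam (d - (primeHeight lam d - 1))) Step.E)

/-- `S` translates to `S'` by `p` units down and `q` units to the right. -/
def TranslatesBy (p q : ℤ) (S S' : Set (ℕ × ℕ)) : Prop :=
  ∀ x y : ℕ, (x, y) ∈ S' ↔ ∃ a b : ℕ, (a, b) ∈ S ∧ (x : ℤ) = a + p ∧ (y : ℤ) = b + q

/-- `S` translates to `S'`. -/
def Translates (S S' : Set (ℕ × ℕ)) : Prop := ∃ p q : ℤ, TranslatesBy p q S S'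

/-- The length of a tableau: its number of distinct labels (for an honest tableau, labels are
exactly `1, …, tlen f`). -/
def tlen (f : ℕ × ℕ → ℕ) : ℕ := sSup {v | v ≠ 0 ∧ ∃ b, f b = v}

/-- The number of boxes in row `x` of a tableau. -/
def rowLen (f : ℕ × ℕ → ℕ) (x : ℕ) : ℕ := sSup {y | f (x, y) ≠ 0}

/-- The number of boxes in column `y` of a tableau. -/
def colLen (f : ℕ × ℕ → ℕ) (y : ℕ) : ℕ := sSup {x | f (x, y) ≠ 0}

/-- `f` is (the entry function of) a tableau: the support is a Young diagram (1-indexed),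
rows strictly increase, columns weakly increase, and the set of labels is exactly
`{1, …, tlen f}`. -/
def IsTableau (f : ℕ × ℕ → ℕ) : Prop :=
  (∀ y, f (0, y) = 0) ∧ (∀ x, f (x, 0) = 0) ∧
  {b : ℕ × ℕ | f b ≠ 0}.Finite ∧
  (∀ x y x' y', 1 ≤ x' → x' ≤ x → 1 ≤ y' → y' ≤ y → f (x, y) ≠ 0 → f (x', y') ≠ 0) ∧
  (∀ x y, f (x, y) ≠ 0 → f (x, y + 1) ≠ 0 → f (x, y) < f (x, y + 1)) ∧
  (∀ x y, f (x, y) ≠ 0 → f (x + 1, y) ≠ 0 → f (x, y) ≤ f (x + 1, y)) ∧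
  (∀ v, 1 ≤ v → (v ≤ tlen f ↔ ∃ b, f b = v))

/-- `T^(r)`: the subtableau of all entries at most `r`. -/
def trunc (f : ℕ × ℕ → ℕ) (r : ℕ) : ℕ × ℕ → ℕ := fun b => if f b ≤ r then f b else 0

/-- The shape (row-length function) of a tableau. -/
def shapeOf (f : ℕ × ℕ → ℕ) : ℕ → ℕ := fun x => rowLen f x

/-- The row index of the end-box of the `k`-set of `f` (the maximal row index of a box
labeled `k`). -/
def endRow (f : ℕ × ℕ → ℕ) (k : ℕ) : ℕ := sSup {x | ∃ y, f (x, y) = k}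

/-- `Y 0 ⋗ Y 1 ⋗ ⋯ ⋗ Y l` is a saturated chain in the Tamari order on Young diagrams whose
maximal element `Y 0` is the empty diagram (each `Y r` covers `Y (r+1)`). -/
def IsTamariChain (Y : ℕ → ℕ → ℕ) (l : ℕ) : Prop :=
  (∀ r, r ≤ l → IsDiagram (Y r)) ∧ (∀ x, Y 0 x = 0) ∧
    ∀ r, r < l → TamariCoverY (Y r) (Y (r + 1))

/-- The tableau `ψ(C)` of the saturated chain `C = (∅ = Y 0 ⋗ ⋯ ⋗ Y l)`: the boxes removed in
the transition `Y (r-1) ⋗ Y r` are labeled `r`; that is, each box of `Y l` is labeled by the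
least `r` such that the box belongs to `Y r`. -/
def psiFun (Y : ℕ → ℕ → ℕ) (l : ℕ) : ℕ × ℕ → ℕ := fun b =>
  if 1 ≤ b.1 ∧ 1 ≤ b.2 ∧ b.2 ≤ Y l b.1 then sInf {r | r ≤ l ∧ b.2 ≤ Y r b.1} else 0

/-- `f` is a `ψ`-tableau: it is in the image of `ψ`. -/
def IsPsiTab (f : ℕ × ℕ → ℕ) : Prop :=
  ∃ l Y, IsTamariChain Y l ∧ f = psiFun Y l

/-- Row lengths of the staircase shape `δ_{n-1} = (n-1, n-2, …, 1)`: row `x ≥ 1` has `n - x`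
boxes. -/
def dstair (n : ℕ) : ℕ → ℕ := fun x => if x = 0 then 0 else n - x

/-- `C_i(n)`, via `ψ`: the set of maximal chains of length `n + i` in the Tamari lattice `T_n`,
identified with the `ψ`-tableaux of length `n + i` and shape `δ_{n-1}`. -/
def MemC (i : ℤ) (n : ℕ) (f : ℕ × ℕ → ℕ) : Prop :=
  IsTableau f ∧ IsPsiTab f ∧ (∀ x, rowLen f x = dstair n x) ∧ (tlen f : ℤ) = (n : ℤ) + i

/-- The `r`-set of `f` (of shape `δ_{n-1}`) is a full-set with end-box `(k, n - k)`:
it begins in row `1` and ends in the outer diagonal, at the box `(k, n - k)`. -/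
def HasFullSetAt (f : ℕ × ℕ → ℕ) (n r k : ℕ) : Prop :=
  (∃ y, f (1, y) = r) ∧ 1 ≤ k ∧ k ≤ n - 1 ∧ f (k, n - k) = r ∧
    ∀ x y, f (x, y) = r → x ≤ k

/-- `f` has an `r`-full-set. -/
def HasFullSet (f : ℕ × ℕ → ℕ) (n r : ℕ) : Prop := ∃ k, HasFullSetAt f n r k

/-- `f` has an `r⁺`-full-set (plus-full-set): an `r`-full-set whose end-box `(k, n-k)` satisfies
`k = n - 1`, or `k ≤ n - 2` and the southwest neighbor has a smaller label. -/
def HasPlusFullSet (f : ℕ × ℕ → ℕ) (n r : ℕ) : Prop :=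
  ∃ k, HasFullSetAt f n r k ∧ (k = n - 1 ∨ (k ≤ n - 2 ∧ f (k + 1, n - k - 1) < r))

/-- `F_i^r(n)`: the set of `C ∈ C_i(n)` whose `r`-set is a plus-full-set and whose `j`-set is
not a plus-full-set for any `j ∈ [r-1]`. -/
def MemF (i : ℤ) (n : ℕ) (r : ℕ) (f : ℕ × ℕ → ℕ) : Prop :=
  MemC i n f ∧ HasPlusFullSet f n r ∧ ∀ j, 1 ≤ j → j < r → ¬ HasPlusFullSet f n j

/-- `N_i(n)`: the set of `C ∈ C_i(n)` having no plus-full-sets. -/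
def MemN (i : ℤ) (n : ℕ) (f : ℕ × ℕ → ℕ) : Prop :=
  MemC i n f ∧ ∀ r, ¬ HasPlusFullSet f n r

/-- `α_d`: shift all rows of index greater than `d` down one row and repeat row `d` in
row `d + 1`. -/
def alphaFun (d : ℕ) (f : ℕ × ℕ → ℕ) : ℕ × ℕ → ℕ := fun b =>
  if b.1 ≤ d then f b else f (b.1 - 1, b.2)

/-- `β_d`: append a box labeled `tlen f + 1` at the end of each of the rows `1, …, d`. -/
def betaFun (d : ℕ) (f : ℕ × ℕ → ℕ) : ℕ × ℕ → ℕ := fun b =>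
  if 1 ≤ b.1 ∧ b.1 ≤ d ∧ b.2 = rowLen f b.1 + 1 then tlen f + 1 else f b

/-- The number of boxes of row `x` of `f` whose label is at most `r` (these occupy an initial
segment of the row). -/
def lowLen (f : ℕ × ℕ → ℕ) (r x : ℕ) : ℕ := sSup {y | f (x, y) ≠ 0 ∧ f (x, y) ≤ r}

/-- The row index `d` used in the definition of `Ĉ(r)`: the minimal `k ∈ [n-1]` with
`C (k, n-k) ≤ r` if such `k` exists, and `n` otherwise. -/
def hatD (f : ℕ × ℕ → ℕ) (n r : ℕ) : ℕ :=
  sInf ({k | 1 ≤ k ∧ k ≤ n - 1 ∧ 1 ≤ f (k, n - k) ∧ f (k, n - k) ≤ r} ∪ {n})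

/-- `Ĉ(r)` for `C ∈ C_i(n)` and `0 ≤ r ≤ n + i`: starting from `β_d(α_d(C^(r)))` (where `d` is
as in `hatD`), the entries of `C` greater than `r` of row index less than `d` are translated one
unit to the right, those of row index greater than `d` are translated one unit down, and all
these labels are incremented by one. -/
def hatFun (f : ℕ × ℕ → ℕ) (n r : ℕ) : ℕ × ℕ → ℕ := fun b =>
  let d := hatD f n r
  let x := b.1
  let y := b.2
  if x = 0 ∨ y = 0 then 0
  else if x ≤ d then
    if f (x, y) ≠ 0 ∧ f (x, y) ≤ r then f (x, y)
    else if y = lowLen f r x + 1 then r + 1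
    else if r < f (x, y - 1) then f (x, y - 1) + 1
    else 0
  else if x = d + 1 then f (d, y)
  else if f (x - 1, y) = 0 then 0
  else if f (x - 1, y) ≤ r then f (x - 1, y)
  else f (x - 1, y) + 1

/-- `RepBy i m t r C0 C` : `C = (φ_{i,m+t-1}^{r 1} ∘ φ_{i,m+t-2}^{r 2} ∘ ⋯ ∘ φ_{i,m}^{r t}) C0`,
each factor being applied within its domain. -/
def RepBy (i : ℤ) (m t : ℕ) (r : ℕ → ℕ) (C0 C : ℕ × ℕ → ℕ) : Prop :=
  ∃ D : ℕ → ℕ × ℕ → ℕ, D 0 = C0 ∧ D t = C ∧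
    ∀ s, s < t →
      MemC i (m + s) (D s) ∧
      ((r (t - s) : ℤ) ≤ (m : ℤ) + s + i) ∧
      (∀ j, 1 ≤ j → j ≤ r (t - s) → ¬ HasPlusFullSet (D s) (m + s) j) ∧
      D (s + 1) = hatFun (D s) (m + s) (r (t - s))

/-- The set `𝕏_{d,n-1}^r` of Theorem 4.3: `ψ`-tableaux of length `r`, contained in `δ_{n-1}`,
whose row `d` has length `n - d` and whose prime path of row `d` has height `d`. -/
def MemX (d n r : ℕ) (f : ℕ × ℕ → ℕ) : Prop :=
  IsTableau f ∧ IsPsiTab f ∧ tlen f = r ∧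
    (∀ x, 1 ≤ x → rowLen f x ≤ n - x) ∧
    rowLen f d = n - d ∧
    primeHeight (shapeOf f) d = d

/-- The set `ℤ_{d,n}^{r+1}` of Theorem 4.3: `ψ`-tableaux of length `r + 1`, contained in `δ_n`,
such that rows `d` and `d+1` of the truncation at `r` are identical, the end-box of the
`(r+1)`-set is `(d, n-d+1)`, and the prime path of `(d, n-d+1)` has height `d`. -/
def MemZ (d n r : ℕ) (g : ℕ × ℕ → ℕ) : Prop :=
  IsTableau g ∧ IsPsiTab g ∧ tlen g = r + 1 ∧
    (∀ x, 1 ≤ x → rowLen g x ≤ n + 1 - x) ∧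
    (∀ y, trunc g r (d, y) = trunc g r (d + 1, y)) ∧
    g (d, n - d + 1) = r + 1 ∧ (∀ x y, g (x, y) = r + 1 → x ≤ d) ∧
    primeHeight (shapeOf g) d = d

/-! ### Covers -/

/-- Row version of the covering relation: rows `a+1, …, d` get one more box. -/
structure CovR (mu lam : ℕ → ℕ) (a d : ℕ) : Prop where
  lt : a < d
  inn : ∀ x, a < x → x ≤ d → lam x = mu x + 1
  low : ∀ x, x ≤ a → lam x = mu x
  high : ∀ x, d < x → lam x = mu x
  mid : ∀ x, a < x → x < d → lam x + x < lam d + d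
  stp : 0 < a → lam d + d ≤ lam a + a
  cor : lam (d + 1) < lam d

theorem IsDiagram.anti {lam : ℕ → ℕ} (h : IsDiagram lam) {x y : ℕ} (hx : 1 ≤ x) (hxy : x ≤ y) :
    lam y ≤ lam x := by
  induction y, hxy using Nat.le_induction with
  | base => exact le_rfl
  | succ k hk ih => exact (h.2.1 k (by omega)).trans ih

theorem covR_of_cover {mu lam : ℕ → ℕ} (hl : IsDiagram lam) (h : TamariCoverY mu lam) :
    ∃ a d, CovR mu lam a d := by
  obtain ⟨d, ⟨h1, h2, h3⟩, rfl⟩ := h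
  set S : Set ℕ := {t | 1 ≤ t ∧ (t = d ∨ (t < d ∧ lam d + t ≤ lam (d - t)))} with hS
  have hmem : primeHeight lam d ∈ S := Nat.sInf_mem (s := S) ⟨d, h1, Or.inl rfl⟩
  have hmin : ∀ t, t ∈ S → primeHeight lam d ≤ t := fun t ht => Nat.sInf_le ht
  generalize hh : primeHeight lam d = h at hmem hmin
  obtain ⟨q1, q2⟩ := hmem
  have hhd : h ≤ d := by rcases q2 with q | q <;> omega
  refine ⟨d - h, d, by omega, ?_, ?_, ?_, ?_, ?_, ?_⟩
  · intro x hx hx'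
    have := hl.anti (x := x) (y := d) (by omega) hx'
    simp only [removeStrip, hh]
    rw [if_pos (by omega)]; omega
  · intro x hx
    simp only [removeStrip, hh]
    rw [if_neg (by omega)]
  · intro x hx
    simp only [removeStrip, hh]
    rw [if_neg (by omega)]
  · intro x hx hx'
    by_contra hc
    have := hmin (d - x) ⟨by omega, Or.inr ⟨by omega, by
      rw [show d - (d - x) = x by omega]; omega⟩⟩
    omega
  · intro ha
    rcases q2 with q | q
    · omega
    · omega
  · exact h3

theorem CovR.cover {mu lam : ℕ → ℕ} {a d : ℕ} (h : CovR mu lam a d) : TamariCoverY mu lam := by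
  have hcor := h.cor
  have hlt := h.lt
  have hp : primeHeight lam d = d - a := by
    apply le_antisymm
    · apply Nat.sInf_le
      refine ⟨by omega, ?_⟩
      rcases Nat.eq_zero_or_pos a with h0 | h0
      · left; omega
      · right
        have := h.stp h0
        rw [show d - (d - a) = a by omega]; omega
    · unfold primeHeight
      apply le_csInf
      · exact ⟨d, by omega, Or.inl rfl⟩
      rintro t ⟨t1, t2⟩
      by_contra hc
      rcases t2 with t2 | ⟨t2, t3⟩
      · omega
      · have := h.mid (d - t) (by omega) (by omega)
        omega
  refine ⟨d, ⟨by omega, by omega, hcor⟩, ?_⟩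
  funext x
  simp only [removeStrip, hp]
  split_ifs with hx
  · have := h.inn x (by omega) (by omega); omega
  · rcases Nat.lt_or_ge d x with hdx | hdx
    · exact (h.high x hdx).symm
    · exact (h.low x (by omega)).symm

/-! ### Chains -/

section chain
variable {Y : ℕ → ℕ → ℕ} {l : ℕ}

theorem chain_cov (hY : IsTamariChain Y l) {j : ℕ} (hj : j < l) :
    ∃ a d, CovR (Y j) (Y (j + 1)) a d :=
  covR_of_cover (hY.1 (j + 1) (by omega)) (hY.2.2 j hj)

theorem CovR.le {mu lam : ℕ → ℕ} {a d : ℕ} (h : CovR mu lam a d) (x : ℕ) :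
    mu x ≤ lam x ∧ lam x ≤ mu x + 1 := by
  rcases Nat.lt_or_ge d x with hx | hx
  · have := h.high x hx; omega
  · rcases Nat.lt_or_ge a x with hx' | hx'
    · have := h.inn x hx' hx; omega
    · have := h.low x hx'; omega

theorem chain_mono (hY : IsTamariChain Y l) (x : ℕ) {j k : ℕ} (hjk : j ≤ k) (hk : k ≤ l) :
    Y j x ≤ Y k x := by
  induction k, hjk using Nat.le_induction with
  | base => exact le_rfl
  | succ k hk' ih =>
    obtain ⟨a, d, h⟩ := chain_cov hY (j := k) (by omega)
    exact (ih (by omega)).trans (h.le x).1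

theorem psi_zero_left (Y : ℕ → ℕ → ℕ) (l y : ℕ) : psiFun Y l (0, y) = 0 := by simp [psiFun]
theorem psi_zero_right (Y : ℕ → ℕ → ℕ) (l x : ℕ) : psiFun Y l (x, 0) = 0 := by simp [psiFun]

theorem psi_spec (hY : IsTamariChain Y l) {x y : ℕ} (hx : 1 ≤ x) (hy : 1 ≤ y) {j : ℕ}
    (hj : j ≤ l) : (psiFun Y l (x, y) ≠ 0 ∧ psiFun Y l (x, y) ≤ j) ↔ y ≤ Y j x := by
  by_cases hb : y ≤ Y l x
  · have he : psiFun Y l (x, y) = sInf {r | r ≤ l ∧ y ≤ Y r x} := by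
      simp [psiFun, hx, hy, hb]
    have hm : psiFun Y l (x, y) ∈ {r | r ≤ l ∧ y ≤ Y r x} := by
      rw [he]; exact Nat.sInf_mem ⟨l, le_rfl, hb⟩
    constructor
    · rintro ⟨-, h⟩
      exact hm.2.trans (chain_mono hY x h hj)
    · intro h
      refine ⟨?_, ?_⟩
      · intro h0
        rw [h0] at hm
        have := hm.2
        rw [hY.2.1 x] at this
        omega
      · rw [he]; exact Nat.sInf_le ⟨hj, h⟩
  · have he : psiFun Y l (x, y) = 0 := by
      simp [psiFun, hb]
    constructor
    · rintro ⟨h, -⟩; exact absurd he h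
    · intro h; exact absurd (h.trans (chain_mono hY x hj le_rfl)) hb

theorem psi_le (hY : IsTamariChain Y l) (b : ℕ × ℕ) : psiFun Y l b ≤ l := by
  obtain ⟨x, y⟩ := b
  by_contra hc
  have h : 1 ≤ x ∧ 1 ≤ y ∧ y ≤ Y l x := by
    by_contra h
    have : psiFun Y l (x, y) = 0 := by simp only [psiFun]; rw [if_neg h]
    omega
  have := (psi_spec hY h.1 h.2.1 le_rfl).2 h.2.2
  omega

theorem psi_ne_zero (hY : IsTamariChain Y l) (x y : ℕ) :
    psiFun Y l (x, y) ≠ 0 ↔ 1 ≤ x ∧ 1 ≤ y ∧ y ≤ Y l x := by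
  constructor
  · intro h
    by_contra hc
    apply h
    simp only [psiFun]; rw [if_neg hc]
  · rintro ⟨h1, h2, h3⟩
    exact ((psi_spec hY h1 h2 le_rfl).2 h3).1

theorem psi_eq (hY : IsTamariChain Y l) {x y : ℕ} {v : ℕ} (hv : v < l) :
    psiFun Y l (x, y) = v + 1 ↔ 1 ≤ x ∧ Y v x < y ∧ y ≤ Y (v + 1) x := by
  by_cases h : 1 ≤ x ∧ 1 ≤ y
  · have h1 := psi_spec hY h.1 h.2 (j := v) (by omega)
    have h2 := psi_spec hY h.1 h.2 (j := v + 1) (by omega)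
    omega
  · have h0 : psiFun Y l (x, y) = 0 := by
      by_contra hc
      have := (psi_ne_zero hY x y).1 hc
      omega
    rw [h0]; omega

theorem sSup_initial {S : Set ℕ} {m : ℕ} (h : ∀ y, y ∈ S ↔ 1 ≤ y ∧ y ≤ m) : sSup S = m := by
  rcases Nat.eq_zero_or_pos m with rfl | hm
  · have : S = ∅ := by
      ext y; rw [h]; simp; omega
    rw [this]; simp
  · have : IsGreatest S m := ⟨(h m).2 ⟨hm, le_rfl⟩, fun y hy => ((h y).1 hy).2⟩
    exact this.csSup_eq

theorem psi_lowLen (hY : IsTamariChain Y l) {x : ℕ} (hx : 1 ≤ x) {j : ℕ} (hj : j ≤ l) :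
    lowLen (psiFun Y l) j x = Y j x := by
  apply sSup_initial
  intro y
  rcases Nat.eq_zero_or_pos y with rfl | hy
  · simp [psi_zero_right]
  · have := psi_spec hY hx hy hj
    simp only [Set.mem_ofPred_eq]
    rw [this]; omega

theorem psi_rowLen (hY : IsTamariChain Y l) (x : ℕ) :
    rowLen (psiFun Y l) x = Y l x := by
  apply sSup_initial
  intro y
  have := psi_ne_zero hY x y
  simp only [Set.mem_ofPred_eq]
  rw [this]
  rcases Nat.eq_zero_or_pos x with rfl | hx
  · have := (hY.1 l le_rfl).1
    omega
  · omega

theorem psi_tlen (hY : IsTamariChain Y l) : tlen (psiFun Y l) = l ∧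
    ∀ v, 1 ≤ v → v ≤ l → ∃ b, psiFun Y l b = v := by
  have key : ∀ v, 1 ≤ v → v ≤ l → ∃ b, psiFun Y l b = v := by
    intro v h1 h2
    obtain ⟨v, rfl⟩ : ∃ w, v = w + 1 := ⟨v - 1, by omega⟩
    obtain ⟨a, d, h⟩ := chain_cov hY (j := v) (by omega)
    have := h.inn d h.lt le_rfl
    exact ⟨(d, Y (v + 1) d), (psi_eq hY (by omega)).2 ⟨by have := h.lt; omega, by omega, le_rfl⟩⟩
  refine ⟨?_, key⟩
  apply sSup_initial
  intro v
  constructor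
  · rintro ⟨h1, b, rfl⟩
    exact ⟨by omega, psi_le hY b⟩
  · rintro ⟨h1, h2⟩
    exact ⟨by omega, key v h1 h2⟩

theorem psi_isTableau (hY : IsTamariChain Y l) : IsTableau (psiFun Y l) := by
  have hd := hY.1 l le_rfl
  obtain ⟨hlen, key⟩ := psi_tlen hY
  refine ⟨psi_zero_left Y l, psi_zero_right Y l, ?_, ?_, ?_, ?_, ?_⟩
  · obtain ⟨N, hN⟩ := hd.2.2
    apply Set.Finite.subset ((Set.finite_Iic N).prod (Set.finite_Iic (Y l 1)))
    rintro ⟨x, y⟩ h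
    have := (psi_ne_zero hY x y).1 h
    have h2 := hd.anti (x := 1) le_rfl this.1
    simp only [Set.mem_prod, Set.mem_Iic]
    refine ⟨?_, by omega⟩
    by_contra hc
    have := hN x (by omega)
    omega
  · intro x y x' y' h1 h2 h3 h4 h
    rw [psi_ne_zero hY] at h ⊢
    have := hd.anti h1 h2
    omega
  · intro x y h h'
    obtain ⟨h1, h2, h3⟩ := (psi_ne_zero hY x y).1 h
    by_contra hc
    obtain ⟨v, hv⟩ : ∃ v, psiFun Y l (x, y) = v + 1 := ⟨psiFun Y l (x, y) - 1, by omega⟩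
    have hvl : v < l := by have := psi_le hY (x, y); omega
    have h5 := (psi_eq hY hvl).1 hv
    have h6 := (psi_spec hY h1 (y := y + 1) (by omega) (j := v + 1) (by omega)).1 ⟨h', by omega⟩
    obtain ⟨a, d, hc⟩ := chain_cov hY hvl
    have := hc.le x
    omega
  · intro x y h h'
    obtain ⟨h1, h2, h3⟩ := (psi_ne_zero hY x y).1 h
    have hle := psi_le hY (x + 1, y)
    have h6 := (psi_spec hY (x := x + 1) (by omega) h2 hle).1 ⟨h', le_rfl⟩
    have h7 := (hY.1 _ hle).2.1 x h1
    exact ((psi_spec hY h1 h2 hle).2 (h6.trans h7)).2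
  · intro v hv
    rw [hlen]
    constructor
    · exact key v hv
    · rintro ⟨b, rfl⟩; exact psi_le hY b

end chain

theorem memC_iff {i : ℤ} {n : ℕ} {f : ℕ × ℕ → ℕ} : MemC i n f ↔
    ∃ l Y, IsTamariChain Y l ∧ f = psiFun Y l ∧ (∀ x, Y l x = dstair n x) ∧ (l : ℤ) = n + i := by
  constructor
  · rintro ⟨-, ⟨l, Y, hY, rfl⟩, h3, h4⟩
    refine ⟨l, Y, hY, rfl, fun x => ?_, ?_⟩
    · rw [← psi_rowLen hY, h3]
    · rw [← h4, (psi_tlen hY).1]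
  · rintro ⟨l, Y, hY, rfl, h3, h4⟩
    exact ⟨psi_isTableau hY, ⟨l, Y, hY, rfl⟩, fun x => by rw [psi_rowLen hY, h3],
      by rw [(psi_tlen hY).1, h4]⟩

/-! ### Reduction of a chain -/

theorem chain_eq_rows {Y : ℕ → ℕ → ℕ} {l : ℕ} (hY : IsTamariChain Y l) {r d : ℕ} (hd : 1 ≤ d)
    (hr : r ≤ l) (h : Y r d = Y r (d + 1)) {j : ℕ} (hj : j ≤ r) : Y j d = Y j (d + 1) := by
  induction hj using Nat.decreasingInduction with
  | self => exact h
  | of_succ k hk ih =>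
    obtain ⟨a, e, hc⟩ := chain_cov hY (j := k) (by omega)
    have i1 := hc.inn d
    have i2 := hc.inn (d + 1)
    have l1 := hc.low d
    have l2 := hc.low (d + 1)
    have h1 := hc.high d
    have h2 := hc.high (d + 1)
    have m2 := hc.mid (d + 1)
    have s := hc.stp
    have c := hc.cor
    have lt := hc.lt
    by_cases e1 : e = d
    · subst e1; omega
    by_cases e2 : a = d
    · subst e2
      by_cases e3 : e = a + 1
      · subst e3; omega
      · omega
    omega

theorem chain_inv {Y : ℕ → ℕ → ℕ} {l : ℕ} (hY : IsTamariChain Y l) {d j k : ℕ}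
    (hjk : j ≤ k) (hk : k ≤ l) (h : ∃ x, 1 ≤ x ∧ x < d ∧ Y j d + d ≤ Y j x + x) :
    ∃ x, 1 ≤ x ∧ x < d ∧ Y k d + d ≤ Y k x + x := by
  induction k, hjk using Nat.le_induction with
  | base => exact h
  | succ k hk' ih =>
    obtain ⟨x, x1, x2, x3⟩ := ih (by omega)
    obtain ⟨a, e, hc⟩ := chain_cov hY (j := k) (by omega)
    by_cases hin : a < d ∧ d ≤ e
    · by_cases hx : a < x
      · have := hc.inn x hx (by omega)
        have := hc.inn d (by omega) (by omega)
        exact ⟨x, x1, x2, by omega⟩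
      · refine ⟨a, by omega, by omega, ?_⟩
        have s := hc.stp (by omega)
        by_cases hde : d = e
        · subst hde; exact s
        · have := hc.mid d (by omega) (by omega); omega
    · have h1 := hc.low d
      have h2 := hc.high d
      have := hc.le x
      exact ⟨x, x1, x2, by omega⟩

/-- The reduced chain. -/
def redY (Y : ℕ → ℕ → ℕ) (r d : ℕ) : ℕ → ℕ → ℕ := fun j x =>
  if j ≤ r then (if x ≤ d then Y j x else Y j (x + 1))
  else (if x ≤ d then Y (j + 1) x - 1 else Y (j + 1) (x + 1))

section red
variable {Y : ℕ → ℕ → ℕ} {l r d n : ℕ}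

theorem redY_ge (hY : IsTamariChain Y (l + 1))
    (hr : r ≤ l)
    (hc : CovR (Y r) (Y (r + 1)) 0 d) {j : ℕ} (hj : r ≤ j) (x : ℕ) :
    redY Y r d j x = if x ≤ d then Y (j + 1) x - 1 else Y (j + 1) (x + 1) := by
  unfold redY
  split_ifs with h1 h2
  · obtain rfl : j = r := by omega
    rcases Nat.eq_zero_or_pos x with rfl | hx
    · rw [hc.low 0 le_rfl]
      have := (hY.1 j (by omega)).1
      omega
    · have := hc.inn x hx h2
      omega
  · obtain rfl : j = r := by omega
    exact (hc.high (x + 1) (by omega)).symm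
  · rfl
  · rfl

theorem redY_chain (hY : IsTamariChain Y (l + 1)) (hr : r ≤ l) (hd : 1 ≤ d) (hdn : d ≤ n)
    (hc : CovR (Y r) (Y (r + 1)) 0 d) (h1 : Y (r + 1) d = n + 1 - d) (h2 : Y r (d + 1) = n - d)
    (h3 : ∀ x, Y (l + 1) x = dstair (n + 1) x) : IsTamariChain (redY Y r d) l := by
  have hrd : Y r d = n - d := by have := hc.inn d (by omega) le_rfl; omega
  have hfull : ∀ j, r + 1 ≤ j → j ≤ l + 1 → Y j d = n + 1 - d ∧ Y j (d + 1) = n - d ∧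
      ∀ x, 1 ≤ x → x ≤ d → 1 ≤ Y j x := by
    intro j hj hj'
    have a1 := chain_mono hY d hj hj'
    have a2 := chain_mono hY d hj' le_rfl
    have a3 := chain_mono hY (d + 1) (j := r) (by omega) hj'
    have a4 := chain_mono hY (d + 1) hj' le_rfl
    rw [h3] at a2 a4
    simp only [dstair] at a2 a4
    rw [if_neg (by omega)] at a2 a4
    refine ⟨by omega, by omega, fun x hx hxd => ?_⟩
    have := chain_mono hY x hj hj'
    have := hc.inn x hx hxd
    omega
  have heq : ∀ j, j ≤ r → Y j d = Y j (d + 1) := fun j hj =>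
    chain_eq_rows hY hd (by omega) (by omega) hj
  have hinv : ∀ j, j ≤ r → ∀ x, 1 ≤ x → x < d → Y j x + x < Y j d + d := by
    intro j hj x hx hxd
    by_contra hcon
    obtain ⟨z, z1, z2, z3⟩ := chain_inv hY hj (by omega) ⟨x, hx, hxd, by omega⟩
    have := hc.mid z (by omega) z2
    have := hc.inn z (by omega) (by omega)
    omega
  refine ⟨?_, ?_, ?_⟩
  · intro j hj
    by_cases hjr : j ≤ r
    · have hD := hY.1 j (by omega)
      refine ⟨?_, ?_, ?_⟩
      · simp [redY, hjr, hD.1]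
      · intro x hx
        simp only [redY, if_pos hjr]
        split_ifs
        · exact hD.2.1 x hx
        · omega
        · exact hD.anti hx (by omega)
        · exact hD.anti (by omega) (by omega)
      · obtain ⟨N, hN⟩ := hD.2.2
        refine ⟨N, fun x hx => ?_⟩
        simp only [redY, if_pos hjr]
        split_ifs
        · exact hN x hx
        · exact hN _ (by omega)
    · have hD := hY.1 (j + 1) (by omega)
      obtain ⟨f1, f2, f3⟩ := hfull (j + 1) (by omega) (by omega)
      refine ⟨?_, ?_, ?_⟩
      · simp [redY, hjr, hD.1]
      · intro x hx
        simp only [redY, if_neg hjr]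
        have := hD.2.1 x hx
        have := hD.2.1 (x + 1) (by omega)
        split_ifs
        · omega
        · omega
        · obtain rfl : x = d := by omega
          omega
        · omega
      · obtain ⟨N, hN⟩ := hD.2.2
        refine ⟨N, fun x hx => ?_⟩
        simp only [redY, if_neg hjr]
        have := hN x hx
        have := hN (x + 1) (by omega)
        split_ifs <;> omega
  · intro x
    simp [redY, hY.2.1]
  · intro j hj
    by_cases hjr : j < r
    · obtain ⟨a, e, he⟩ := chain_cov hY (j := j) (by omega)
      have hX : ∀ x, redY Y r d j x = if x ≤ d then Y j x else Y j (x + 1) := by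
        intro x; simp only [redY]; rw [if_pos (by omega)]
      have hX' : ∀ x, redY Y r d (j + 1) x = if x ≤ d then Y (j + 1) x else Y (j + 1) (x + 1) := by
        intro x; simp only [redY]; rw [if_pos (by omega)]
      have e0 := heq j (by omega)
      have e1 := heq (j + 1) (by omega)
      have iv := hinv (j + 1) (by omega)
      generalize redY Y r d j = X at hX
      generalize redY Y r d (j + 1) = X' at hX'
      generalize Y j = M at *
      generalize Y (j + 1) = L at *
      obtain ⟨elt, einn, elow, ehigh, emid, estp, ecor⟩ := he
      rcases lt_trichotomy e d with hed | hed | hed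
      · refine CovR.cover (a := a) (d := e) ⟨elt, ?_, ?_, ?_, ?_, ?_, ?_⟩
        · intro x _ _
          rw [hX, hX', if_pos (by omega), if_pos (by omega)]; exact einn x (by omega) (by omega)
        · intro x _
          rw [hX, hX', if_pos (by omega), if_pos (by omega)]; exact elow x (by omega)
        · intro x _
          rw [hX, hX']
          split_ifs
          · exact ehigh x (by omega)
          · exact ehigh _ (by omega)
        · intro x _ _
          rw [hX', hX', if_pos (by omega), if_pos (by omega)]; exact emid x (by omega) (by omega)
        · intro _
          rw [hX', hX', if_pos (by omega), if_pos (by omega)]; exact estp (by omega)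
        · rw [hX', hX', if_pos (by omega), if_pos (by omega)]; exact ecor
      · subst hed; omega
      · obtain ⟨e, rfl⟩ : ∃ e', e = e' + 1 := ⟨e - 1, by omega⟩
        have hXe : X' e = L (e + 1) := by
          rw [hX']
          split_ifs
          · obtain rfl : e = d := by omega
            exact e1
          · rfl
        rcases Nat.lt_or_ge d a with had | had
        · obtain ⟨a, rfl⟩ : ∃ e', a = e' + 1 := ⟨a - 1, by omega⟩
          refine CovR.cover (a := a) (d := e) ⟨by omega, ?_, ?_, ?_, ?_, ?_, ?_⟩
          · intro x _ _
            rw [hX, hX', if_neg (by omega), if_neg (by omega)]; exact einn _ (by omega) (by omega)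
          · intro x _
            rw [hX, hX']
            split_ifs
            · exact elow x (by omega)
            · exact elow _ (by omega)
          · intro x _
            rw [hX, hX', if_neg (by omega), if_neg (by omega)]; exact ehigh _ (by omega)
          · intro x _ _
            rw [hXe, hX', if_neg (by omega)]
            have := emid (x + 1) (by omega) (by omega); omega
          · intro _
            have := estp (by omega)
            rw [hXe, hX']
            split_ifs
            · obtain rfl : a = d := by omega
              omega
            · omega
          · rw [hXe, hX', if_neg (by omega)]; exact ecor
        · have had' : a ≠ d := by
            rintro rfl
            have := estp (by omega)
            by_cases hh : e = a
            · subst hh; omega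
            · have := emid (a + 1) (by omega) (by omega); omega
          refine CovR.cover (a := a) (d := e) ⟨by omega, ?_, ?_, ?_, ?_, ?_, ?_⟩
          · intro x _ _
            rw [hX, hX']
            split_ifs
            · exact einn _ (by omega) (by omega)
            · exact einn _ (by omega) (by omega)
          · intro x _
            rw [hX, hX', if_pos (by omega), if_pos (by omega)]; exact elow x (by omega)
          · intro x _
            rw [hX, hX', if_neg (by omega), if_neg (by omega)]; exact ehigh _ (by omega)
          · intro x _ _
            rw [hXe, hX']
            split_ifs
            · have := emid d (by omega) (by omega)
              by_cases hxd : x = d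
              · subst hxd
                have := emid (x + 1) (by omega) (by omega); omega
              · have := iv x (by omega) (by omega); omega
            · have := emid (x + 1) (by omega) (by omega); omega
          · intro _
            have := estp (by omega)
            rw [hXe, hX', if_pos (by omega)]
            omega
          · rw [hXe, hX', if_neg (by omega)]; exact ecor
    · obtain ⟨a, e, he⟩ := chain_cov hY (j := j + 1) (by omega)
      obtain ⟨f1, f2, f3⟩ := hfull (j + 1) (by omega) (by omega)
      obtain ⟨g1, g2, g3⟩ := hfull (j + 1 + 1) (by omega) (by omega)
      have hX := redY_ge hY hr hc (j := j) (by omega)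
      have hX' := redY_ge hY hr hc (j := j + 1) (by omega)
      have z1 := (hY.1 (j + 1) (by omega)).1
      have z2 := (hY.1 (j + 1 + 1) (by omega)).1
      generalize redY Y r d j = X at hX
      generalize redY Y r d (j + 1) = X' at hX'
      generalize Y (j + 1) = M at *
      generalize Y (j + 1 + 1) = L at *
      obtain ⟨elt, einn, elow, ehigh, emid, estp, ecor⟩ := he
      have i1 := einn d
      have i2 := einn (d + 1)
      rcases Nat.lt_or_ge e d with hed | hed
      · refine CovR.cover (a := a) (d := e) ⟨elt, ?_, ?_, ?_, ?_, ?_, ?_⟩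
        · intro x _ _
          rw [hX, hX', if_pos (by omega), if_pos (by omega)]
          have := einn x (by omega) (by omega)
          have := f3 x (by omega) (by omega)
          omega
        · intro x _
          rw [hX, hX', if_pos (by omega), if_pos (by omega)]
          have := elow x (by omega); omega
        · intro x _
          rw [hX, hX']
          have := ehigh x (by omega)
          have := ehigh (x + 1) (by omega)
          split_ifs <;> omega
        · intro x _ _
          rw [hX', hX', if_pos (by omega), if_pos (by omega)]
          have := emid x (by omega) (by omega)
          have := g3 x (by omega) (by omega)
          omega
        · intro _
          rw [hX', hX', if_pos (by omega), if_pos (by omega)]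
          have := estp (by omega)
          have := g3 e (by omega) (by omega)
          omega
        · rw [hX', hX', if_pos (by omega), if_pos (by omega)]
          have := g3 (e + 1) (by omega) (by omega)
          omega
      · have : d + 1 ≤ a := by
          by_contra hcon
          by_cases hed' : e = d
          · subst hed'; omega
          · omega
        obtain ⟨e, rfl⟩ : ∃ e', e = e' + 1 := ⟨e - 1, by omega⟩
        obtain ⟨a, rfl⟩ : ∃ e', a = e' + 1 := ⟨a - 1, by omega⟩
        have hXe : X' e = L (e + 1) := by rw [hX', if_neg (by omega)]
        refine CovR.cover (a := a) (d := e) ⟨by omega, ?_, ?_, ?_, ?_, ?_, ?_⟩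
        · intro x _ _
          rw [hX, hX', if_neg (by omega), if_neg (by omega)]; exact einn _ (by omega) (by omega)
        · intro x _
          rw [hX, hX']
          split_ifs
          · have := elow x (by omega); omega
          · exact elow _ (by omega)
        · intro x _
          rw [hX, hX', if_neg (by omega), if_neg (by omega)]; exact ehigh _ (by omega)
        · intro x _ _
          rw [hXe, hX', if_neg (by omega)]
          have := emid (x + 1) (by omega) (by omega); omega
        · intro _
          have := estp (by omega)
          rw [hXe, hX']
          split_ifs
          · obtain rfl : a = d := by omega
            omega
          · omega
        · rw [hXe, hX', if_neg (by omega)]; exact ecor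

end red
/-! ### The map `hatFun` -/

/-- Elementary facts on tableaux of staircase shape used for `hatFun`. -/
structure Good (f : ℕ × ℕ → ℕ) (n : ℕ) : Prop where
  supp : ∀ x y, f (x, y) ≠ 0 ↔ 1 ≤ x ∧ 1 ≤ y ∧ x + y ≤ n
  low : ∀ r x y, 1 ≤ x → 1 ≤ y → ((f (x, y) ≠ 0 ∧ f (x, y) ≤ r) ↔ y ≤ lowLen f r x)

theorem good_of_memC {i : ℤ} {n : ℕ} {f : ℕ × ℕ → ℕ} (h : MemC i n f) : Good f n := by
  obtain ⟨l, Y, hY, rfl, h3, h4⟩ := memC_iff.1 h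
  have hs : ∀ x y, psiFun Y l (x, y) ≠ 0 ↔ 1 ≤ x ∧ 1 ≤ y ∧ x + y ≤ n := by
    intro x y
    rw [psi_ne_zero hY, h3]
    simp only [dstair]
    split_ifs <;> omega
  refine ⟨hs, ?_⟩
  intro r x y hx hy
  by_cases hr : r ≤ l
  · rw [psi_spec hY hx hy hr, psi_lowLen hY hx hr]
  · have e : lowLen (psiFun Y l) r x = Y l x := by
      apply sSup_initial
      intro y
      have a1 := psi_ne_zero hY x y
      have a2 := psi_le hY (x, y)
      simp only [Set.mem_ofPred_eq]
      omega
    have a1 := psi_ne_zero hY x y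
    have a2 := psi_le hY (x, y)
    rw [e]
    omega

section hat
variable {f : ℕ × ℕ → ℕ} {n r : ℕ}

theorem hatD_spec (hf : Good f n) (hn : 1 ≤ n) : 1 ≤ hatD f n r ∧ hatD f n r ≤ n ∧
    f (hatD f n r, n - hatD f n r) ≤ r ∧
    ∀ k, 1 ≤ k → k < hatD f n r → r < f (k, n - k) := by
  set S := ({k | 1 ≤ k ∧ k ≤ n - 1 ∧ 1 ≤ f (k, n - k) ∧ f (k, n - k) ≤ r} ∪ {n}) with hS
  have hm : hatD f n r ∈ S := Nat.sInf_mem (s := S) ⟨n, Or.inr rfl⟩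
  have hmin : ∀ k, k ∈ S → hatD f n r ≤ k := fun k hk => Nat.sInf_le hk
  generalize hatD f n r = d at hm hmin
  have hdn : d ≤ n := hmin n (Or.inr rfl)
  refine ⟨?_, hdn, ?_, ?_⟩
  · rcases hm with h | h
    · exact h.1
    · have : d = n := h
      omega
  · rcases hm with h | h
    · exact h.2.2.2
    · have h : d = n := h
      have := hf.supp d (n - d)
      omega
  · intro k h1 h2
    by_contra hc
    have := hf.supp k (n - k)
    have := hmin k (Or.inl ⟨h1, by omega, by omega, by omega⟩)
    omega

theorem hatD_eq (hf : Good f n) {d : ℕ} (hd : 1 ≤ d) (hdn : d ≤ n)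
    (h1 : f (d, n - d) ≤ r) (h2 : ∀ k, 1 ≤ k → k < d → r < f (k, n - k)) : hatD f n r = d := by
  obtain ⟨a1, a2, a3, a4⟩ := hatD_spec (r := r) hf (by omega)
  generalize hatD f n r = d' at *
  have b1 := h2 d'
  have b2 := a4 d
  omega

/-- Explicit description of `hatFun`. -/
structure HatSpec (f g : ℕ × ℕ → ℕ) (n r d : ℕ) : Prop where
  one : 1 ≤ d
  le : d ≤ n
  dle : f (d, n - d) ≤ r
  dmin : ∀ k, 1 ≤ k → k < d → r < f (k, n - k)
  zl : ∀ y, g (0, y) = 0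
  zr : ∀ x, g (x, 0) = 0
  up_low : ∀ x y, x ≤ d → f (x, y) ≠ 0 → f (x, y) ≤ r → g (x, y) = f (x, y)
  up_new : ∀ x, 1 ≤ x → x ≤ d → g (x, lowLen f r x + 1) = r + 1
  up_high : ∀ x y, x ≤ d → r < f (x, y) → g (x, y + 1) = f (x, y) + 1
  up_zero : ∀ x y, 1 ≤ x → x ≤ d → g (x, y) ≤ r → g (x, y) = f (x, y) ∨ g (x, y) = 0
  up_inv : ∀ x y, x ≤ d → r + 1 < g (x, y) → 1 ≤ y ∧ f (x, y - 1) + 1 = g (x, y) ∧ r < f (x, y - 1)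
  row : ∀ y, g (d + 1, y) = f (d, y)
  row_le : ∀ y, f (d, y) ≤ r
  dn_low : ∀ x y, d < x → f (x, y) ≤ r → g (x + 1, y) = f (x, y)
  dn_high : ∀ x y, d < x → r < f (x, y) → g (x + 1, y) = f (x, y) + 1

theorem hat_spec (hf : Good f n) (hn : 1 ≤ n) :
    HatSpec f (hatFun f n r) n r (hatD f n r) := by
  obtain ⟨a1, a2, a3, a4⟩ := hatD_spec (r := r) hf hn
  have hz1 : ∀ y, f (0, y) = 0 := fun y => by have := hf.supp 0 y; omega
  have hz2 : ∀ x, f (x, 0) = 0 := fun x => by have := hf.supp x 0; omega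
  have hrow : ∀ y, f (hatD f n r, y) ≤ r := by
    intro y
    by_contra hc
    have h1 := hf.supp (hatD f n r) y
    have h2 := hf.supp (hatD f n r) (n - hatD f n r)
    have h3 := hf.low r (hatD f n r) y
    have h4 := hf.low r (hatD f n r) (n - hatD f n r)
    omega
  have hg : ∀ x y, hatFun f n r (x, y) =
      if x = 0 ∨ y = 0 then 0
      else if x ≤ hatD f n r then
        if f (x, y) ≠ 0 ∧ f (x, y) ≤ r then f (x, y)
        else if y = lowLen f r x + 1 then r + 1
        else if r < f (x, y - 1) then f (x, y - 1) + 1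
        else 0
      else if x = hatD f n r + 1 then f (hatD f n r, y)
      else if f (x - 1, y) = 0 then 0
      else if f (x - 1, y) ≤ r then f (x - 1, y)
      else f (x - 1, y) + 1 := fun x y => rfl
  generalize hatFun f n r = g at *
  generalize hatD f n r = d at *
  refine ⟨a1, a2, a3, a4, ?_, ?_, ?_, ?_, ?_, ?_, ?_, ?_, hrow, ?_, ?_⟩
  · intro y; rw [hg]; simp
  · intro x; rw [hg]; simp
  · intro x y h1 h2 h3
    have := hf.supp x y
    rw [hg, if_neg (by omega), if_pos h1, if_pos ⟨h2, h3⟩]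
  · intro x h1 h2
    have := hf.low r x (lowLen f r x + 1) h1 (by omega)
    rw [hg, if_neg (by omega), if_pos h2, if_neg (by omega), if_pos rfl]
  · intro x y h1 h2
    have b := hf.supp x y
    have c := hf.low r x (y + 1) (by omega) (by omega)
    have c' := hf.low r x y (by omega) (by omega)
    rw [hg, if_neg (by omega), if_pos h1, if_neg (by omega), if_neg (by omega)]
    simp [h2]
  · intro x y h1 h2 h3
    rw [hg] at h3 ⊢
    split_ifs at h3 ⊢ <;> omega
  · intro x y h1 h2
    rw [hg] at h2 ⊢
    split_ifs at h2 ⊢ <;> omega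
  · intro y
    by_cases hy : y = 0
    · subst hy; rw [hg]; simp [hz2]
    · rw [hg, if_neg (by omega), if_neg (by omega), if_pos rfl]
  · intro x y h1 h2
    by_cases hy : y = 0
    · subst hy; rw [hg]; simp [hz2]
    · rw [hg, if_neg (by omega), if_neg (by omega), if_neg (by omega)]
      simp only [Nat.add_sub_cancel]
      split_ifs <;> omega
  · intro x y h1 h2
    have b := hf.supp x y
    rw [hg, if_neg (by omega), if_neg (by omega), if_neg (by omega)]
    simp only [Nat.add_sub_cancel]
    split_ifs <;> omega

variable {g : ℕ × ℕ → ℕ} {d : ℕ}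

theorem HatSpec.dn (h : HatSpec f g n r d) (x y : ℕ) (hx : d < x) :
    (f (x, y) ≤ r ∧ g (x + 1, y) = f (x, y)) ∨ (r < f (x, y) ∧ g (x + 1, y) = f (x, y) + 1) := by
  rcases Nat.lt_or_ge r (f (x, y)) with h1 | h1
  · exact Or.inr ⟨h1, h.dn_high x y hx h1⟩
  · exact Or.inl ⟨h1, h.dn_low x y hx h1⟩

theorem HatSpec.gd (h : HatSpec f g n r d) (hf : Good f n) : g (d, n + 1 - d) = r + 1 := by
  have h1 := h.up_new d h.one le_rfl
  have : lowLen f r d = n - d := by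
    have h1 := h.one
    have h2 := h.le
    have h3 := h.dle
    have a1 := hf.low r d (n - d) h.one
    have a2 := hf.supp d (n - d)
    have a3 := hf.low r d (lowLen f r d) h.one
    have a4 := hf.supp d (lowLen f r d)
    omega
  rw [this] at h1
  have := h.le
  rwa [show n + 1 - d = n - d + 1 by omega]

theorem HatSpec.max_new (h : HatSpec f g n r d) (x y : ℕ) (hg : g (x, y) = r + 1) : x ≤ d := by
  by_contra hc
  obtain ⟨x, rfl⟩ : ∃ z, x = z + 1 := ⟨x - 1, by omega⟩
  by_cases hx : x = d
  · subst hx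
    have := h.row y
    have := h.row_le y
    omega
  · have := h.dn x y (by omega)
    omega

theorem HatSpec.plus_new (h : HatSpec f g n r d) (hf : Good f n) :
    HasPlusFullSet g (n + 1) (r + 1) := by
  have h1 := h.one
  have h2 := h.le
  refine ⟨d, ⟨⟨_, h.up_new 1 le_rfl h1⟩, h1, by omega, h.gd hf, fun x y => h.max_new x y⟩, ?_⟩
  by_cases hd : d = n
  · left; omega
  · right
    refine ⟨by omega, ?_⟩
    rw [h.row, show n + 1 - d - 1 = n - d by omega]
    have := h.dle
    omega

/-- Relabeling of the labels of `f` inside `hatFun f n r`. -/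
def tau (r j : ℕ) : ℕ := if j ≤ r then j else j + 1

theorem tau_lt {r j k : ℕ} : tau r j < tau r k ↔ j < k := by
  unfold tau; split_ifs <;> omega

theorem tau_ne {r j : ℕ} : tau r j ≠ r + 1 := by
  unfold tau; split_ifs <;> omega

theorem tau_inj {r j k : ℕ} : tau r j = tau r k ↔ j = k := by
  unfold tau; split_ifs <;> omega

/-- Row of `hatFun f n r` corresponding to a row of `f`. -/
def rho (d k : ℕ) : ℕ := if k < d then k else k + 1

theorem HatSpec.fwd (h : HatSpec f g n r d) {x y j : ℕ} (hj : 1 ≤ j) (hf : f (x, y) = j) :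
    ∃ y', g (rho d x, y') = tau r j := by
  subst hf
  unfold rho tau
  rcases lt_trichotomy x d with hx | rfl | hx
  · rw [if_pos hx]
    split_ifs with h1
    · exact ⟨y, h.up_low x y hx.le (by omega) h1⟩
    · exact ⟨y + 1, h.up_high x y hx.le (by omega)⟩
  · rw [if_neg (by omega), if_pos (h.row_le y)]
    exact ⟨y, h.row y⟩
  · rw [if_neg (by omega)]
    refine ⟨y, ?_⟩
    rcases h.dn x y hx with ⟨h1, h2⟩ | ⟨h1, h2⟩
    · rw [if_pos h1, h2]
    · rw [if_neg (by omega), h2]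

theorem HatSpec.bwd (h : HatSpec f g n r d) {x y j : ℕ} (hj : 1 ≤ j) (hg : g (x, y) = tau r j) :
    (x ≤ d ∧ ∃ y', f (x, y') = j) ∨ (∃ z, x = z + 1 ∧ d ≤ z ∧ f (z, y) = j) := by
  have hx0 : x ≠ 0 := by
    rintro rfl
    rw [h.zl] at hg
    unfold tau at hg
    split_ifs at hg; omega
  rcases Nat.lt_or_ge d x with hx | hx
  · right
    obtain ⟨z, rfl⟩ : ∃ z, x = z + 1 := ⟨x - 1, by omega⟩
    refine ⟨z, rfl, by omega, ?_⟩
    by_cases hz : z = d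
    · subst hz
      have h1 := h.row y
      have h2 := h.row_le y
      unfold tau at hg
      split_ifs at hg <;> omega
    · have h1 := h.dn z y (by omega)
      unfold tau at hg
      split_ifs at hg <;> omega
  · left
    refine ⟨hx, ?_⟩
    unfold tau at hg
    split_ifs at hg with h1
    · rcases h.up_zero x y (by omega) hx (by omega) with e | e
      · exact ⟨y, by omega⟩
      · omega
    · obtain ⟨e1, e2, e3⟩ := h.up_inv x y hx (by omega)
      exact ⟨y - 1, by omega⟩

theorem HatSpec.diag (h : HatSpec f g n r d) {k : ℕ} (hk : 1 ≤ k) (hkn : k ≤ n - 1) :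
    g (rho d k, n + 1 - rho d k) = tau r (f (k, n - k)) := by
  unfold rho tau
  rcases lt_trichotomy k d with hx | rfl | hx
  · have h1 := h.dmin k hk hx
    rw [if_pos hx, if_neg (by omega), show n + 1 - k = n - k + 1 by omega]
    exact h.up_high k _ hx.le h1
  · rw [if_neg (by omega), if_pos (h.row_le _), show n + 1 - (k + 1) = n - k by omega]
    exact h.row _
  · rw [if_neg (by omega), show n + 1 - (k + 1) = n - k by omega]
    rcases h.dn k (n - k) hx with ⟨h1, h2⟩ | ⟨h1, h2⟩
    · rw [if_pos h1, h2]
    · rw [if_neg (by omega), h2]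

theorem HatSpec.full_iff (h : HatSpec f g n r d) {k j : ℕ} (hj : 1 ≤ j)
    (hk : 1 ≤ k) (hkn : k ≤ n - 1) :
    HasFullSetAt g (n + 1) (tau r j) (rho d k) ↔ HasFullSetAt f n j k := by
  have hd := h.one
  unfold HasFullSetAt
  rw [h.diag hk hkn, tau_inj]
  have hr : rho d k = if k < d then k else k + 1 := rfl
  constructor
  · rintro ⟨⟨y, hy⟩, -, -, h4, h5⟩
    refine ⟨?_, hk, hkn, h4, ?_⟩
    · rcases h.bwd hj hy with ⟨-, e⟩ | ⟨z, e1, e2, e3⟩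
      · exact e
      · omega
    · intro x y hxy
      obtain ⟨y', hy'⟩ := h.fwd hj hxy
      have := h5 _ _ hy'
      unfold rho at this
      split_ifs at this <;> omega
  · rintro ⟨⟨y, hy⟩, -, -, h4, h5⟩
    refine ⟨?_, ?_, ?_, h4, ?_⟩
    · by_cases h1 : 1 < d
      · have := h.fwd hj hy
        unfold rho at this
        rwa [if_pos h1] at this
      · obtain rfl : d = 1 := by omega
        have a1 := h.row_le y
        exact ⟨y, by
          unfold tau
          rw [if_pos (by omega), h.up_low 1 y le_rfl (by omega) a1, hy]⟩
    · split_ifs at hr <;> omega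
    · split_ifs at hr <;> omega
    · intro x y hxy
      rcases h.bwd hj hxy with ⟨e0, y', e⟩ | ⟨z, e1, e2, e3⟩
      · have := h5 _ _ e
        split_ifs at hr <;> omega
      · have := h5 _ _ e3
        split_ifs at hr <;> omega

theorem HatSpec.plus_iff (h : HatSpec f g n r d) (hf : Good f n) {j : ℕ} (hj : 1 ≤ j) :
    HasPlusFullSet g (n + 1) (tau r j) ↔ HasPlusFullSet f n j := by
  have hd1 := h.one
  have hdn := h.le
  have hgd := h.gd hf
  have key : ∀ k, 1 ≤ k → k ≤ n - 1 → f (k, n - k) = j →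
      ((rho d k = n + 1 - 1 ∨ (rho d k ≤ n + 1 - 2 ∧
        g (rho d k + 1, n + 1 - rho d k - 1) < tau r j)) ↔
      (k = n - 1 ∨ (k ≤ n - 2 ∧ f (k + 1, n - k - 1) < j))) := by
    intro k hk hkn hfk
    by_cases hkd : k + 1 = d
    · have h1 := h.dmin k hk (by omega)
      have h2 := h.dle
      have hr : rho d k = k := by unfold rho; rw [if_pos (by omega)]
      have ht : tau r j = j + 1 := by unfold tau; rw [if_neg (by omega)]
      rw [hr, ht, hkd, show n + 1 - k - 1 = n + 1 - d by omega, hgd,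
        show n - k - 1 = n - d by omega]
      omega
    · have hr : rho d (k + 1) = rho d k + 1 := by
        unfold rho; split_ifs <;> omega
      by_cases hk1 : k = n - 1
      · have : rho d k = n := by unfold rho; split_ifs <;> omega
        constructor
        · intro _; exact Or.inl hk1
        · intro _; left; omega
      · have hD := h.diag (k := k + 1) (by omega) (by omega)
        rw [hr] at hD
        rw [show n + 1 - rho d k - 1 = n + 1 - (rho d k + 1) by omega, hD,
          show n - k - 1 = n - (k + 1) by omega, tau_lt]
        have : rho d k ≤ n - 1 := by unfold rho; split_ifs <;> omega
        have : rho d k = n → k = n - 1 := by unfold rho; split_ifs <;> omega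
        omega
  constructor
  · rintro ⟨k', hk', hp⟩
    have hne : k' ≠ d := by
      rintro rfl
      have := hk'.2.2.2.1
      rw [hgd] at this
      exact tau_ne this.symm
    have b1 := hk'.2.1
    have b2 := hk'.2.2.1
    obtain ⟨k, rfl, k1, k2⟩ : ∃ k, k' = rho d k ∧ 1 ≤ k ∧ k ≤ n - 1 := by
      unfold rho
      rcases Nat.lt_or_ge k' d with e | e
      · exact ⟨k', by rw [if_pos e], by omega, by omega⟩
      · exact ⟨k' - 1, by rw [if_neg (by omega)]; omega, by omega, by omega⟩
    have hF := (h.full_iff hj k1 k2).1 hk'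
    exact ⟨k, hF, (key k k1 k2 hF.2.2.2.1).1 hp⟩
  · rintro ⟨k, hF, hp⟩
    exact ⟨rho d k, (h.full_iff hj hF.2.1 hF.2.2.1).2 hF,
      (key k hF.2.1 hF.2.2.1 hF.2.2.2.1).2 hp⟩

theorem plus_pos (hf : Good f n) {j : ℕ} (h : HasPlusFullSet f n j) : 1 ≤ j := by
  obtain ⟨k, ⟨-, h1, h2, h3, -⟩, -⟩ := h
  have := hf.supp k (n - k)
  omega

/-- The set of plus-full-sets of `g = hatFun f n r`. -/
theorem HatSpec.plus_set (h : HatSpec f g n r d) (hf : Good f n) (hg : Good g (n + 1)) :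
    {j | HasPlusFullSet g (n + 1) j} = insert (r + 1) (Set.image (tau r) {j | HasPlusFullSet f n j}) := by
  ext j
  simp only [Set.mem_ofPred_eq, Set.mem_insert_iff, Set.mem_image]
  constructor
  · intro hj
    have hj1 := plus_pos hg hj
    by_cases hjr : j = r + 1
    · exact Or.inl hjr
    · right
      obtain ⟨k, hk1, rfl⟩ : ∃ k, 1 ≤ k ∧ tau r k = j := by
        by_cases hle : j ≤ r
        · exact ⟨j, hj1, by unfold tau; rw [if_pos hle]⟩
        · exact ⟨j - 1, by omega, by unfold tau; rw [if_neg (by omega)]; omega⟩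
      exact ⟨k, (h.plus_iff hf hk1).1 hj, rfl⟩
  · rintro (rfl | ⟨k, hk, rfl⟩)
    · exact h.plus_new hf
    · exact (h.plus_iff hf (plus_pos hf hk)).2 hk

/-- `r + 1` is the least plus-full-set of `hatFun f n r`. -/
theorem HatSpec.least (h : HatSpec f g n r d) (hf : Good f n) (hg : Good g (n + 1))
    (hno : ∀ j, 1 ≤ j → j ≤ r → ¬ HasPlusFullSet f n j) :
    ∀ j, HasPlusFullSet g (n + 1) j → r + 1 ≤ j := by
  intro j hj
  have : j ∈ {j | HasPlusFullSet g (n + 1) j} := hj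
  rw [h.plus_set hf hg] at this
  rcases this with rfl | ⟨k, hk, rfl⟩
  · exact le_rfl
  · have h1 := hno k (plus_pos hf hk)
    unfold tau
    split_ifs with h2
    · exact absurd hk (h1 h2)
    · omega

theorem hat_inj {f f' g : ℕ × ℕ → ℕ} {d d' : ℕ} (h : HatSpec f g n r d) (h' : HatSpec f' g n r d')
    (hf : Good f n) (hf' : Good f' n) : f = f' := by
  have e1 := h.max_new _ _ (h'.gd hf')
  have e2 := h'.max_new _ _ (h.gd hf)
  obtain rfl : d = d' := by omega
  have key : ∀ {f f' : ℕ × ℕ → ℕ}, HatSpec f g n r d → HatSpec f' g n r d → Good f n →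
      Good f' n → ∀ x y, f (x, y) ≠ 0 → f' (x, y) = f (x, y) := by
    intro f f' h h' hf hf' x y h0
    have h0' := (hf'.supp x y).2 ((hf.supp x y).1 h0)
    have hx := (hf.supp x y).1 h0
    rcases lt_trichotomy x d with hxd | rfl | hxd
    · by_cases hr : f (x, y) ≤ r
      · have a := h.up_low x y hxd.le h0 hr
        rcases h'.up_zero x y hx.1 hxd.le (by omega) with b | b <;> omega
      · have a := h.up_high x y hxd.le (by omega)
        have b := (h'.up_inv x (y + 1) hxd.le (by omega)).2.1
        simp only [Nat.add_sub_cancel] at b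
        omega
    · rw [← h.row, ← h'.row]
    · have a := h.dn x y hxd
      have b := h'.dn x y hxd
      omega
  funext ⟨x, y⟩
  by_cases h0 : f (x, y) = 0
  · by_contra hne
    exact hne (key h' h hf' hf x y (fun h1 => hne (by rw [h0, h1])))
  · exact (key h h' hf hf' x y h0).symm

end hat
/-! ### Surjectivity -/

theorem psi_congr {Y X : ℕ → ℕ → ℕ} {l l' r x x' y : ℕ} (hY : IsTamariChain Y l)
    (hX : IsTamariChain X l') (hr : r ≤ l) (hr' : r ≤ l') (hx : 1 ≤ x) (hx' : 1 ≤ x') (hy : 1 ≤ y)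
    (h : ∀ j, j ≤ r → Y j x = X j x') (hyr : y ≤ Y r x) :
    psiFun Y l (x, y) = psiFun X l' (x', y) := by
  have a := (psi_spec hY hx hy hr).2 hyr
  have b := (psi_spec hX hx' hy hr').2 (by rw [← h r le_rfl]; exact hyr)
  apply le_antisymm
  · apply ((psi_spec hY hx hy (by omega)).2 _).2
    rw [h _ b.2]
    exact (psi_spec hX hx' hy (by omega)).1 ⟨b.1, le_rfl⟩
  · apply ((psi_spec hX hx' hy (by omega)).2 _).2
    rw [← h _ a.2]
    exact (psi_spec hY hx hy (by omega)).1 ⟨a.1, le_rfl⟩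

theorem hat_surj {i : ℤ} {n r : ℕ} {g : ℕ × ℕ → ℕ} (hg : MemC i (n + 1) g)
    (hp : HasPlusFullSet g (n + 1) (r + 1)) :
    1 ≤ n ∧ (r : ℤ) ≤ n + i ∧ ∃ f, MemC i n f ∧ hatFun f n r = g := by
  obtain ⟨L, Y, hY, rfl, h3, h4⟩ := memC_iff.1 hg
  obtain ⟨d, ⟨⟨y1, hy1⟩, hd, hdn, hgd, hmax⟩, hplus⟩ := hp
  simp only [Nat.add_sub_cancel] at hdn
  have hrL : r + 1 ≤ L := by
    have := psi_le hY (d, n + 1 - d); omega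
  obtain ⟨l, rfl⟩ : ∃ l, L = l + 1 := ⟨L - 1, by omega⟩
  have h3' : ∀ x, 1 ≤ x → Y (l + 1) x = n + 1 - x := by
    intro x hx
    rw [h3]; unfold dstair; rw [if_neg (by omega)]
  obtain ⟨a, e, hc⟩ := chain_cov hY (j := r) (by omega)
  have b1 := (psi_eq hY (by omega)).1 hy1
  have b2 := (psi_eq hY (by omega)).1 hgd
  have a0 : a = 0 := by
    by_contra h0
    have := hc.low 1 (by omega)
    omega
  subst a0
  have hde : d = e := by
    apply le_antisymm
    · by_contra hcon
      have := hc.high d (by omega)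
      omega
    · have h5 := hc.inn e hc.lt le_rfl
      exact hmax e (Y (r + 1) e) ((psi_eq hY (by omega)).2 ⟨hc.lt, by omega, le_rfl⟩)
  subst hde
  have hin := hc.inn d (by omega) le_rfl
  have m1 := chain_mono hY d (j := r + 1) (k := l + 1) (by omega) le_rfl
  rw [h3' d hd] at m1
  have k1 : Y (r + 1) d = n + 1 - d := by omega
  have m2 := chain_mono hY (d + 1) (j := r) (k := l + 1) (by omega) le_rfl
  rw [h3' (d + 1) (by omega)] at m2
  have k2 : Y r (d + 1) = n - d := by
    rcases hplus with hh | ⟨hh, hh'⟩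
    · omega
    · have s1 := (psi_ne_zero hY (d + 1) (n + 1 - d - 1)).2
        ⟨by omega, by omega, by rw [h3' _ (by omega)]; omega⟩
      have s2 := (psi_spec hY (x := d + 1) (y := n + 1 - d - 1) (by omega) (by omega) (j := r)
        (by omega)).1 ⟨s1, by omega⟩
      omega
  have hX := redY_chain hY (by omega) hd hdn hc k1 k2 h3
  have hge := fun {j : ℕ} (hj : r ≤ j) => redY_ge hY (by omega) hc (j := j) hj
  have hle : ∀ j x, j ≤ r → redY Y r d j x = if x ≤ d then Y j x else Y j (x + 1) := by
    intro j x hj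
    simp only [redY]; rw [if_pos hj]
  have hpos : ∀ j, r + 1 ≤ j → j ≤ l + 1 → ∀ x, 1 ≤ x → x ≤ d → 1 ≤ Y j x := by
    intro j hj hj' x hx hxd
    have := chain_mono hY x hj hj'
    have := hc.inn x hx hxd
    omega
  have heq : ∀ j, j ≤ r → Y j d = Y j (d + 1) := fun j hj =>
    chain_eq_rows hY hd (by omega) (by omega) hj
  have hz := (hY.1 (l + 1) le_rfl).1
  have hl := hge (j := l) (by omega)
  have hmem : MemC i n (psiFun (redY Y r d) l) := by
    refine memC_iff.2 ⟨l, _, hX, rfl, fun x => ?_, by push_cast at h4; omega⟩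
    rw [hl]
    unfold dstair
    by_cases hx0 : x = 0
    · subst hx0; simp [hz]
    · rw [if_neg hx0, h3' x (by omega), h3' (x + 1) (by omega)]
      split_ifs <;> omega
  refine ⟨by omega, by push_cast at h4; omega, _, hmem, ?_⟩
  have hG := good_of_memC hmem
  have hlow : ∀ x, 1 ≤ x → lowLen (psiFun (redY Y r d) l) r x = redY Y r d r x :=
    fun x hx => psi_lowLen hX hx (by omega)
  have hD : hatD (psiFun (redY Y r d) l) n r = d := by
    apply hatD_eq hG hd hdn
    · by_cases hdn' : d = n
      · have := (hG.supp d (n - d)); omega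
      · refine ((hG.low r d (n - d) hd (by omega)).2 ?_).2
        rw [hlow d hd, hle r d le_rfl, if_pos le_rfl]
        omega
    · intro k hk1 hk2
      by_contra hcon
      have s1 := (hG.supp k (n - k)).2 ⟨hk1, by omega, by omega⟩
      have s2 := (hG.low r k (n - k) hk1 (by omega)).1 ⟨s1, by omega⟩
      rw [hlow k hk1, hle r k le_rfl, if_pos (by omega)] at s2
      have := hc.mid k (by omega) hk2
      have := hc.inn k (by omega) (by omega)
      omega
  funext ⟨x, y⟩
  show (if x = 0 ∨ y = 0 then 0 else _) = _
  by_cases h0 : x = 0 ∨ y = 0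
  · rw [if_pos h0]
    have := psi_ne_zero hY x y
    omega
  rw [if_neg h0]
  have hx : 1 ≤ x := by omega
  have hy : 1 ≤ y := by omega
  simp only [hD]
  by_cases hxd : x ≤ d
  · rw [if_pos hxd]
    have sp := hG.low r x y hx hy
    rw [hlow x hx] at sp ⊢
    have hrx := hle r x le_rfl
    rw [if_pos hxd] at hrx
    rw [hrx] at sp ⊢
    split_ifs with c1 c2 c3
    · refine psi_congr hX hY (r := r) (by omega) (by omega) hx hx hy ?_ ?_
      · intro j hj
        rw [hle j x hj, if_pos hxd]
      · rw [hrx]; exact sp.1 c1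
    · symm
      refine (psi_eq hY (by omega)).2 ⟨hx, by omega, ?_⟩
      rw [hc.inn x (by omega) hxd]; omega
    · obtain ⟨v, hv⟩ : ∃ v, psiFun (redY Y r d) l (x, y - 1) = v + 1 := ⟨_, (Nat.sub_add_cancel
        (show 1 ≤ psiFun (redY Y r d) l (x, y - 1) by omega)).symm⟩
      have vl := psi_le hX (x, y - 1)
      obtain ⟨-, v1, v2⟩ := (psi_eq hX (by omega)).1 hv
      rw [hge (by omega), if_pos hxd] at v1 v2
      have p1 := hpos (v + 1) (by omega) (by omega) x hx hxd
      have p2 := hpos (v + 1 + 1) (by omega) (by omega) x hx hxd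
      rw [hv]
      symm
      exact (psi_eq hY (by omega)).2 ⟨hx, by omega, by omega⟩
    · symm
      by_contra hcon
      obtain ⟨-, -, w⟩ := (psi_ne_zero hY x y).1 hcon
      have hlx := hl x
      rw [if_pos hxd] at hlx
      have w1 := (psi_ne_zero hX x (y - 1)).2 ⟨hx, by omega, by omega⟩
      have w2 := (psi_spec hX hx (y := y - 1) (by omega) (j := r) (by omega)).1 ⟨w1, by omega⟩
      rw [hrx] at w2
      omega
  · rw [if_neg hxd]
    split_ifs with c1 c2 c3
    · subst c1
      by_cases hyn : y ≤ n - d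
      · refine psi_congr hX hY (r := r) (by omega) (by omega) hd hx hy ?_ ?_
        · intro j hj
          rw [hle j d hj, if_pos le_rfl]; exact heq j hj
        · rw [hle r d le_rfl, if_pos le_rfl]; omega
      · have s1 := hG.supp d y
        have s2 := psi_ne_zero hY (d + 1) y
        rw [h3' _ hx] at s2
        omega
    · have s1 := hG.supp (x - 1) y
      have s2 := psi_ne_zero hY x y
      rw [h3' _ hx] at s2
      omega
    · obtain ⟨z, rfl⟩ : ∃ z, x = z + 1 := ⟨x - 1, by omega⟩
      simp only [Nat.add_sub_cancel] at c2 c3 ⊢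
      refine psi_congr hX hY (r := r) (by omega) (by omega) (by omega) hx hy ?_ ?_
      · intro j hj
        rw [hle j z hj, if_neg (by omega)]
      · exact (psi_spec hX (by omega) hy (by omega)).1 ⟨c2, c3⟩
    · obtain ⟨z, rfl⟩ : ∃ z, x = z + 1 := ⟨x - 1, by omega⟩
      simp only [Nat.add_sub_cancel] at c2 c3 ⊢
      obtain ⟨v, hv⟩ : ∃ v, psiFun (redY Y r d) l (z, y) = v + 1 := ⟨_, (Nat.sub_add_cancel
        (show 1 ≤ psiFun (redY Y r d) l (z, y) by omega)).symm⟩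
      have vl := psi_le hX (z, y)
      obtain ⟨-, v1, v2⟩ := (psi_eq hX (by omega)).1 hv
      rw [hge (by omega), if_neg (by omega)] at v1 v2
      rw [hv]
      symm
      exact (psi_eq hY (by omega)).2 ⟨hx, v1, v2⟩

/-! ### The main induction -/

theorem main_induction (i : ℤ) (t : ℕ) : ∀ (n : ℕ), 1 ≤ n → ∀ (C : ℕ × ℕ → ℕ), MemC i n C →
    {j : ℕ | HasPlusFullSet C n j}.Finite → Set.ncard {j : ℕ | HasPlusFullSet C n j} = t →
    t < n ∧ ∃ C0 : ℕ × ℕ → ℕ, ∃ r : ℕ → ℕ,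
      (MemN i (n - t) C0 ∧ RepBy i (n - t) t r C0 C) ∧
      ∀ C0' : ℕ × ℕ → ℕ, ∀ r' : ℕ → ℕ,
        MemN i (n - t) C0' → RepBy i (n - t) t r' C0' C →
          C0' = C0 ∧ ∀ j, 1 ≤ j → j ≤ t → r' j = r j := by
  induction t with
  | zero =>
    intro n hn C hC hfin hcard
    refine ⟨hn, C, fun _ => 0, ⟨⟨hC, ?_⟩, ⟨fun _ => C, rfl, rfl, fun s hs => by omega⟩⟩, ?_⟩
    · intro r hr
      have := (Set.ncard_eq_zero hfin).1 hcard
      have h : r ∈ {j : ℕ | HasPlusFullSet C n j} := hr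
      rw [this] at h
      exact h
    · rintro C0' r' - ⟨D, h1, h2, -⟩
      exact ⟨by rw [← h1, h2], fun j h1 h2 => by omega⟩
  | succ t ih =>
    intro n hn C hC hfin hcard
    obtain ⟨m, rfl⟩ : ∃ m, n = m + 1 := ⟨n - 1, by omega⟩
    have hGC := good_of_memC hC
    have hne : ∃ j, HasPlusFullSet C (m + 1) j := by
      by_contra hcon
      push Not at hcon
      have : {j : ℕ | HasPlusFullSet C (m + 1) j} = ∅ := by
        ext j; simp [hcon j]
      rw [this] at hcard
      simp at hcard
    classical
    obtain ⟨r, hr1, hr2⟩ : ∃ r, HasPlusFullSet C (m + 1) (r + 1) ∧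
        ∀ j, HasPlusFullSet C (m + 1) j → r + 1 ≤ j := by
      have h1 := Nat.find_spec hne
      have h2 := plus_pos hGC h1
      refine ⟨Nat.find hne - 1, ?_, ?_⟩
      · rwa [Nat.sub_add_cancel h2]
      · intro j hj
        rw [Nat.sub_add_cancel h2]
        exact Nat.find_min' hne hj
    obtain ⟨hm, hrm, f, hf, hfC⟩ := hat_surj hC hr1
    have hGf := good_of_memC hf
    have hS := hat_spec (r := r) hGf hm
    rw [hfC] at hS
    have hset := hS.plus_set hGf hGC
    have hno : ∀ j, 1 ≤ j → j ≤ r → ¬ HasPlusFullSet f m j := by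
      intro j h1 h2 h3
      have h4 := hr2 _ ((hS.plus_iff hGf h1).2 h3)
      unfold tau at h4
      rw [if_pos h2] at h4
      omega
    have hinj : Function.Injective (tau r) := fun a b h => tau_inj.1 h
    have hfi : (Set.image (tau r) {j | HasPlusFullSet f m j}).Finite :=
      hfin.subset (by rw [hset]; exact Set.subset_insert _ _)
    have hfin' : {j | HasPlusFullSet f m j}.Finite := hfi.of_finite_image hinj.injOn
    have hcard' : Set.ncard {j | HasPlusFullSet f m j} = t := by
      rw [hset, Set.ncard_insert_of_notMem _ hfi, Set.ncard_image_of_injective _ hinj] at hcard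
      · omega
      · rintro ⟨k, -, hk⟩
        exact tau_ne hk
    obtain ⟨htm, C0, r0, ⟨hN, D, hD0, hDt, hD⟩, huniq⟩ := ih m hm f hf hfin' hcard'
    have hsub : m + 1 - (t + 1) = m - t := by omega
    rw [hsub]
    refine ⟨by omega, C0, fun j => if j ≤ 1 then r else r0 (j - 1), ⟨hN,
      fun s => if s ≤ t then D s else C, ?_, ?_, ?_⟩, ?_⟩
    · simp [hD0]
    · simp
    · intro s hs
      by_cases hst : s < t
      · obtain ⟨q1, q2, q3, q4⟩ := hD s hst
        have e1 : ¬ (t + 1 - s ≤ 1) := by omega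
        have e2 : t + 1 - s - 1 = t - s := by omega
        simp only [if_pos hst.le, if_neg e1, e2, if_pos (show s + 1 ≤ t from hst)]
        exact ⟨q1, q2, q3, q4⟩
      · obtain rfl : s = t := by omega
        have e1 : s + 1 - s ≤ 1 := by omega
        have e3 : m - s + s = m := by omega
        simp only [if_pos le_rfl, if_pos e1, if_neg (show ¬ (s + 1 ≤ s) by omega), e3, hDt]
        exact ⟨hf, by omega, hno, hfC.symm⟩
    · rintro C0' r' hN' ⟨D', h0', ht', hD'⟩
      obtain ⟨q1, q2, q3, q4⟩ := hD' t (by omega)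
      have e1 : t + 1 - t = 1 := by omega
      have e3 : m - t + t = m := by omega
      rw [e3] at q1 q3 q4
      rw [e1] at q3 q4
      rw [ht'] at q4
      have hGD := good_of_memC q1
      have hS' := hat_spec (r := r' 1) hGD hm
      rw [← q4] at hS'
      have hrr : r' 1 = r := by
        have u1 := hr2 _ (hS'.plus_new hGD)
        have u2 := hS'.least hGD hGC q3 _ hr1
        omega
      rw [hrr] at hS'
      have hDf : D' t = f := hat_inj hS' hS hGD hGf
      obtain ⟨v1, v2⟩ := huniq C0' (fun j => r' (j + 1)) hN' ⟨D', h0', hDf, by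
        intro s hs
        obtain ⟨w1, w2, w3, w4⟩ := hD' s (by omega)
        rw [show t + 1 - s = t - s + 1 by omega] at w2 w3 w4
        exact ⟨w1, w2, w3, w4⟩⟩
      refine ⟨v1, fun j hj1 hj2 => ?_⟩
      by_cases hj : j ≤ 1
      · obtain rfl : j = 1 := by omega
        simpa using hrr
      · simp only [if_neg hj]
        have := v2 (j - 1) (by omega) (by omega)
        rwa [Nat.sub_add_cancel hj1] at this

/-- **Corollary 5.3.**  Suppose `C ∈ C_i(n)` has exactly `t > 0` plus-full-sets.  Then there
exist a unique `C̃ ∈ N_i(n - t)` and a unique `t`-tuple `(r 1, …, r t)` such that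
`C = (φ_{i,n-1}^{r 1} ∘ φ_{i,n-2}^{r 2} ∘ ⋯ ∘ φ_{i,n-t}^{r t}) C̃`. -/
theorem unique_representation (i : ℤ) (hi : -1 ≤ i) (n : ℕ) (hn : 1 ≤ n)
    (C : ℕ × ℕ → ℕ) (hC : MemC i n C) (t : ℕ) (ht : 0 < t)
    (hnum : Set.ncard {j : ℕ | HasPlusFullSet C n j} = t) :
    ∃ C0 : ℕ × ℕ → ℕ, ∃ r : ℕ → ℕ,
      (MemN i (n - t) C0 ∧ RepBy i (n - t) t r C0 C) ∧
      ∀ C0' : ℕ × ℕ → ℕ, ∀ r' : ℕ → ℕ,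
        MemN i (n - t) C0' → RepBy i (n - t) t r' C0' C →
          C0' = C0 ∧ ∀ j, 1 ≤ j → j ≤ t → r' j = r j := by
  exact (main_induction i t n hn C hC (Set.finite_of_ncard_pos (by omega)) hnum).2

end TamariMaxChains
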